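/- Let M₄ be the 16×16 integer matrix of the previous statement. Then the number of vectors in the ℤ-span of the rows of M₄ all of whose 16 coordinates lie in {1, −1} is exactly 2048. -/

import Mathlib

/-- The rows of the generator matrix `M₄` of (4 times) the lattice `Λ` of the paper. -/
def M4rows : Fin 16 → Fin 16 → ℤ :=
  ![![1,1,1,1,1,1,1,1,1,1,1,1,1,1,1,1],
    ![0,2,0,0,0,0,0,2,0,0,0,2,0,2,0,0],
    ![0,0,2,0,0,0,0,2,0,0,0,2,0,0,2,0],
    ![0,0,0,2,0,0,0,2,0,0,0,2,0,0,0,2],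
    ![0,0,0,0,2,0,0,2,0,0,0,0,0,2,2,0],
    ![0,0,0,0,0,2,0,2,0,0,0,0,0,2,0,2],
    ![0,0,0,0,0,0,2,2,0,0,0,0,0,0,2,2],
    ![0,0,0,0,0,0,0,4,0,0,0,0,0,0,0,0],
    ![0,0,0,0,0,0,0,0,2,0,0,2,0,2,2,0],
    ![0,0,0,0,0,0,0,0,0,2,0,2,0,2,0,2],
    ![0,0,0,0,0,0,0,0,0,0,2,2,0,0,2,2],
    ![0,0,0,0,0,0,0,0,0,0,0,4,0,0,0,0],
    ![0,0,0,0,0,0,0,0,0,0,0,0,2,2,2,2],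
    ![0,0,0,0,0,0,0,0,0,0,0,0,0,4,0,0],
    ![0,0,0,0,0,0,0,0,0,0,0,0,0,0,4,0],
    ![0,0,0,0,0,0,0,0,0,0,0,0,0,0,0,4]]

/-- The span of the rows of `M₄` is cut out by congruences: all coordinates have the same parity,
and five sums of eight coordinates are divisible by `4`. -/
theorem mem_span_range_M4rows_iff (v : Fin 16 → ℤ) :
    v ∈ Submodule.span ℤ (Set.range M4rows) ↔
      (∀ i, 2 ∣ v i - v 0) ∧
      4 ∣ v 0 + v 1 + v 2 + v 3 + v 4 + v 5 + v 6 + v 7 ∧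
      4 ∣ v 0 + v 1 + v 2 + v 3 + v 8 + v 9 + v 10 + v 11 ∧
      4 ∣ v 0 + v 1 + v 4 + v 5 + v 8 + v 9 + v 12 + v 13 ∧
      4 ∣ v 0 + v 2 + v 4 + v 6 + v 8 + v 10 + v 12 + v 14 ∧
      4 ∣ v 0 + v 3 + v 5 + v 6 + v 9 + v 10 + v 12 + v 15 := by
  rw [Submodule.mem_span_range_iff_exists_fun]
  constructor
  · rintro ⟨c, rfl⟩
    simp only [Fin.forall_fin_succ, Fin.sum_univ_succ, M4rows]
    simp
    omega
  · rintro ⟨h, h₇, h₁₁, h₁₃, h₁₄, h₁₅⟩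
    choose a ha using h
    have hv : ∀ i, v i = v 0 + 2 * a i := fun i => by linarith [ha i]
    obtain ⟨b₇, hb₇⟩ : 2 ∣ a 7 - (a 1 + a 2 + a 3 + a 4 + a 5 + a 6) := by
      simp only [hv 1, hv 2, hv 3, hv 4, hv 5, hv 6, hv 7] at h₇
      omega
    obtain ⟨b₁₁, hb₁₁⟩ : 2 ∣ a 11 - (a 1 + a 2 + a 3 + a 8 + a 9 + a 10) := by
      simp only [hv 1, hv 2, hv 3, hv 8, hv 9, hv 10, hv 11] at h₁₁
      omega
    obtain ⟨b₁₃, hb₁₃⟩ : 2 ∣ a 13 - (a 1 + a 4 + a 5 + a 8 + a 9 + a 12) := by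
      simp only [hv 1, hv 4, hv 5, hv 8, hv 9, hv 12, hv 13] at h₁₃
      omega
    obtain ⟨b₁₄, hb₁₄⟩ : 2 ∣ a 14 - (a 2 + a 4 + a 6 + a 8 + a 10 + a 12) := by
      simp only [hv 2, hv 4, hv 6, hv 8, hv 10, hv 12, hv 14] at h₁₄
      omega
    obtain ⟨b₁₅, hb₁₅⟩ : 2 ∣ a 15 - (a 3 + a 5 + a 6 + a 9 + a 10 + a 12) := by
      simp only [hv 3, hv 5, hv 6, hv 9, hv 10, hv 12, hv 15] at h₁₅
      omega
    refine ⟨![v 0, a 1, a 2, a 3, a 4, a 5, a 6, b₇, a 8, a 9, a 10, b₁₁, a 12, b₁₃, b₁₄, b₁₅], ?_⟩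
    ext i
    rw [Finset.sum_apply]
    fin_cases i <;> simp [Fin.sum_univ_succ, M4rows] <;> grind

/-- The pivot columns of `M₄`, those whose diagonal entry is not `4`. -/
def pivotColumn : Fin 11 → Fin 16 := ![0, 1, 2, 3, 4, 5, 6, 8, 9, 10, 12]

theorem Int.exists_sign_four_dvd_add {n : ℤ} (hn : Odd n) :
    ∃ e : ℤ, (e = 1 ∨ e = -1) ∧ 4 ∣ n + e := by
  obtain ⟨k, rfl⟩ := hn
  obtain h | h : 4 ∣ 2 * k + 1 + 1 ∨ 4 ∣ 2 * k + 1 + -1 := by omega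
  · exact ⟨1, .inl rfl, h⟩
  · exact ⟨-1, .inr rfl, h⟩

/-- A sign vector in the span is determined by its signs in the pivot columns. -/
theorem sign_vector_ext {v w : Fin 16 → ℤ}
    (hv : v ∈ Submodule.span ℤ (Set.range M4rows)) (hw : w ∈ Submodule.span ℤ (Set.range M4rows))
    (hv₁ : ∀ i, v i = 1 ∨ v i = -1) (hw₁ : ∀ i, w i = 1 ∨ w i = -1)
    (h : ∀ k, v (pivotColumn k) = w (pivotColumn k)) : v = w := by
  rw [mem_span_range_M4rows_iff] at hv hw
  obtain ⟨-, hv₇, hv₁₁, hv₁₃, hv₁₄, hv₁₅⟩ := hv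
  obtain ⟨-, hw₇, hw₁₁, hw₁₃, hw₁₄, hw₁₅⟩ := hw
  simp [Fin.forall_fin_succ, pivotColumn] at h
  obtain ⟨h₀, h₁, h₂, h₃, h₄, h₅, h₆, h₈, h₉, h₁₀, h₁₂⟩ := h
  rw [h₀, h₁, h₂, h₃, h₄, h₅, h₆] at hv₇
  rw [h₀, h₁, h₂, h₃, h₈, h₉, h₁₀] at hv₁₁
  rw [h₀, h₁, h₄, h₅, h₈, h₉, h₁₂] at hv₁₃
  rw [h₀, h₂, h₄, h₆, h₈, h₁₀, h₁₂] at hv₁₄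
  rw [h₀, h₃, h₅, h₆, h₉, h₁₀, h₁₂] at hv₁₅
  have key : ∀ (j : Fin 16) (n : ℤ), 4 ∣ n + v j → 4 ∣ n + w j → v j = w j := fun j n _ _ => by
    have := hv₁ j
    have := hw₁ j
    omega
  ext i
  fin_cases i
  exacts [h₀, h₁, h₂, h₃, h₄, h₅, h₆, key _ _ hv₇ hw₇, h₈, h₉, h₁₀, key _ _ hv₁₁ hw₁₁, h₁₂,
    key _ _ hv₁₃ hw₁₃, key _ _ hv₁₄ hw₁₄, key _ _ hv₁₅ hw₁₅]

/-- The signs in the pivot columns of a sign vector in the span can be prescribed arbitrarily. -/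
theorem exists_sign_vector {s : Fin 11 → ℤ} (hs : ∀ k, s k = 1 ∨ s k = -1) :
    ∃ v ∈ Submodule.span ℤ (Set.range M4rows),
      (∀ i, v i = 1 ∨ v i = -1) ∧ ∀ k, v (pivotColumn k) = s k := by
  have odd_s : ∀ k, Odd (s k) := fun k => by
    rcases hs k with h | h <;> rw [h] <;> decide
  have odd_sum (a b c d e f g : Fin 11) : Odd (s a + s b + s c + s d + s e + s f + s g) :=
    ((((((odd_s a).add_odd (odd_s b)).add_odd (odd_s c)).add_odd (odd_s d)).add_odd
      (odd_s e)).add_odd (odd_s f)).add_odd (odd_s g)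
  obtain ⟨e₇, he₇, h₇⟩ := Int.exists_sign_four_dvd_add (odd_sum 0 1 2 3 4 5 6)
  obtain ⟨e₁₁, he₁₁, h₁₁⟩ := Int.exists_sign_four_dvd_add (odd_sum 0 1 2 3 7 8 9)
  obtain ⟨e₁₃, he₁₃, h₁₃⟩ := Int.exists_sign_four_dvd_add (odd_sum 0 1 4 5 7 8 10)
  obtain ⟨e₁₄, he₁₄, h₁₄⟩ := Int.exists_sign_four_dvd_add (odd_sum 0 2 4 6 7 9 10)
  obtain ⟨e₁₅, he₁₅, h₁₅⟩ := Int.exists_sign_four_dvd_add (odd_sum 0 3 5 6 8 9 10)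
  let v : Fin 16 → ℤ :=
    ![s 0, s 1, s 2, s 3, s 4, s 5, s 6, e₇, s 7, s 8, s 9, e₁₁, s 10, e₁₃, e₁₄, e₁₅]
  have hv : ∀ i, v i = 1 ∨ v i = -1 := fun i => by
    fin_cases i
    exacts [hs 0, hs 1, hs 2, hs 3, hs 4, hs 5, hs 6, he₇, hs 7, hs 8, hs 9, he₁₁, hs 10,
      he₁₃, he₁₄, he₁₅]
  refine ⟨v, ?_, hv, fun k => by fin_cases k <;> rfl⟩
  rw [mem_span_range_M4rows_iff]
  refine ⟨fun i => ?_, h₇, h₁₁, h₁₃, h₁₄, h₁₅⟩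
  have := hv i
  have := hv 0
  omega

theorem stmt_13 :
    Nat.card {v : Fin 16 → ℤ //
      v ∈ Submodule.span ℤ (Set.range M4rows) ∧ ∀ i : Fin 16, v i = 1 ∨ v i = -1} = 2048 := by
  let f : {v : Fin 16 → ℤ //
      v ∈ Submodule.span ℤ (Set.range M4rows) ∧ ∀ i : Fin 16, v i = 1 ∨ v i = -1} →
      Fin 11 → Bool := fun v k => decide (v.1 (pivotColumn k) = 1)
  have hf : Function.Bijective f := by
    constructor
    · rintro ⟨v, hv, hv₁⟩ ⟨w, hw, hw₁⟩ hvw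
      refine Subtype.ext (sign_vector_ext hv hw hv₁ hw₁ fun k => ?_)
      change v (pivotColumn k) = w (pivotColumn k)
      have hk : v (pivotColumn k) = 1 ↔ w (pivotColumn k) = 1 := by
        simpa [f] using congrFun hvw k
      have := hv₁ (pivotColumn k)
      have := hw₁ (pivotColumn k)
      omega
    · intro b
      obtain ⟨v, hv, hv₁, hvb⟩ := exists_sign_vector (s := fun k => if b k then 1 else -1)
        fun k => by cases b k <;> simp
      refine ⟨⟨v, hv, hv₁⟩, funext fun k => ?_⟩
      cases hb : b k <;> simp [f, hvb, hb]
  rw [Nat.card_eq_of_bijective f hf]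
  simp
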